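/- Let X ∈ ℝ^{n×d}, B* ∈ ℝ^{d×q}, W ∈ ℝ^{n×q}, and Y = X B* + W. Suppose B̂ minimizes F(B) = (1/2)‖Y − X B‖_F² + λ‖B‖_{2,1} over ℝ^{d×q}, with λ ≥ 2‖Xᵀ W‖_{2,∞} and λ > 0. Let S = {i : B*_{i:} ≠ 0} be the set of nonzero rows of B*, and write Δ = B̂ − B*. Let Δ_S be the matrix agreeing with Δ on rows in S and zero elsewhere, and Δ_{S^c} = Δ − Δ_S. Then the error lies in the cone ‖Δ_{S^c}‖_{2,1} ≤ 3‖Δ_S‖_{2,1}. -/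

import Mathlib

open Matrix BigOperators

/-- The Frobenius norm of a real matrix: `‖A‖_F = sqrt (Σ_{i,j} A_{ij}²)`. -/
noncomputable def frobNorm {m n : ℕ} (A : Matrix (Fin m) (Fin n) ℝ) : ℝ :=
  Real.sqrt (∑ i, ∑ j, (A i j) ^ 2)

/-- The Euclidean norm of the `i`-th row of a real matrix. -/
noncomputable def rowNorm {m n : ℕ} (A : Matrix (Fin m) (Fin n) ℝ) (i : Fin m) : ℝ :=
  Real.sqrt (∑ j, (A i j) ^ 2)

/-- The `ℓ_{2,1}`-norm of a real matrix: the sum of the Euclidean norms of its rows. -/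
noncomputable def l21Norm {m n : ℕ} (A : Matrix (Fin m) (Fin n) ℝ) : ℝ :=
  ∑ i, rowNorm A i

/-- The `ℓ_{2,∞}`-norm of a real matrix: the maximal Euclidean norm of a row. -/
noncomputable def l2infNorm {m n : ℕ} (A : Matrix (Fin m) (Fin n) ℝ) : ℝ :=
  ⨆ i, rowNorm A i

theorem frobNorm_sq {m n : ℕ} (A : Matrix (Fin m) (Fin n) ℝ) :
    frobNorm A ^ 2 = ∑ i, ∑ j, A i j ^ 2 :=
  Real.sq_sqrt (Finset.sum_nonneg fun _ _ => Finset.sum_nonneg fun _ _ => sq_nonneg _)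

theorem rowNorm_eq_norm_toLp {m n : ℕ} (A : Matrix (Fin m) (Fin n) ℝ) (i : Fin m) :
    rowNorm A i = ‖WithLp.toLp 2 (A i)‖ := by
  simp [rowNorm, EuclideanSpace.norm_eq]

theorem rowNorm_nonneg {m n : ℕ} (A : Matrix (Fin m) (Fin n) ℝ) (i : Fin m) :
    0 ≤ rowNorm A i :=
  Real.sqrt_nonneg _

theorem rowNorm_congr {m n : ℕ} {A B : Matrix (Fin m) (Fin n) ℝ} {i : Fin m}
    (h : A i = B i) : rowNorm A i = rowNorm B i := by
  simp [rowNorm, h]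

theorem rowNorm_eq_zero {m n : ℕ} {A : Matrix (Fin m) (Fin n) ℝ} {i : Fin m}
    (h : A i = 0) : rowNorm A i = 0 := by
  simp [rowNorm, h]

theorem rowNorm_le_rowNorm_add_rowNorm_sub {m n : ℕ} (A B : Matrix (Fin m) (Fin n) ℝ)
    (i : Fin m) : rowNorm B i ≤ rowNorm A i + rowNorm (A - B) i := by
  simp only [rowNorm_eq_norm_toLp]
  exact norm_le_norm_add_norm_sub (WithLp.toLp 2 (A i)) (WithLp.toLp 2 (B i))

theorem rowNorm_le_l2infNorm {m n : ℕ} (A : Matrix (Fin m) (Fin n) ℝ) (i : Fin m) :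
    rowNorm A i ≤ l2infNorm A :=
  le_ciSup (Set.finite_range (rowNorm A)).bddAbove i

/-- Hölder's inequality for the dual pair `ℓ_{2,∞}`, `ℓ_{2,1}`. -/
theorem sum_mul_le_l2infNorm_mul_l21Norm {m n : ℕ} (A B : Matrix (Fin m) (Fin n) ℝ) :
    ∑ i, ∑ j, A i j * B i j ≤ l2infNorm A * l21Norm B := by
  rw [l21Norm, Finset.mul_sum]
  refine Finset.sum_le_sum fun i _ => ?_
  calc ∑ j, A i j * B i j ≤ rowNorm A i * rowNorm B i :=
        Real.sum_mul_le_sqrt_mul_sqrt _ _ _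
    _ ≤ l2infNorm A * rowNorm B i :=
        mul_le_mul_of_nonneg_right (rowNorm_le_l2infNorm A i) (rowNorm_nonneg B i)

theorem sum_mul_mul_apply_eq_sum_transpose_mul {m n p : ℕ} (X : Matrix (Fin m) (Fin n) ℝ)
    (W : Matrix (Fin m) (Fin p) ℝ) (D : Matrix (Fin n) (Fin p) ℝ) :
    ∑ i, ∑ j, W i j * (X * D) i j = ∑ k, ∑ j, (Xᵀ * W) k j * D k j := by
  simp only [Matrix.mul_apply, Matrix.transpose_apply, Finset.mul_sum, Finset.sum_mul]
  rw [Finset.sum_congr rfl fun i _ => Finset.sum_comm, Finset.sum_comm]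
  refine Finset.sum_congr rfl fun k _ => ?_
  rw [Finset.sum_comm]
  exact Finset.sum_congr rfl fun j _ => Finset.sum_congr rfl fun i _ => by ring

theorem frobNorm_sub_sq {m n : ℕ} (A B : Matrix (Fin m) (Fin n) ℝ) :
    frobNorm (A - B) ^ 2 =
      frobNorm A ^ 2 - 2 * ∑ i, ∑ j, A i j * B i j + frobNorm B ^ 2 := by
  simp only [frobNorm_sq, Finset.mul_sum, ← Finset.sum_sub_distrib, ← Finset.sum_add_distrib,
    Matrix.sub_apply]
  exact Finset.sum_congr rfl fun i _ => Finset.sum_congr rfl fun j _ => by ring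

/-- **Cone condition for the group-lasso error.** If `Y = X B* + W`, `B̂` minimizes
`B ↦ (1/2)‖Y − X B‖_F² + λ‖B‖_{2,1}` with `λ ≥ 2‖Xᵀ W‖_{2,∞}` and `λ > 0`, and
`S = {i : B*_{i:} ≠ 0}` is the set of nonzero rows of `B*`, then the error
`Δ = B̂ − B*` satisfies `‖Δ_{S^c}‖_{2,1} ≤ 3‖Δ_S‖_{2,1}`, where `Δ_S` agrees with `Δ` on
rows in `S` and vanishes elsewhere, and `Δ_{S^c} = Δ − Δ_S`. -/
theorem group_lasso_cone_condition {n d q : ℕ}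
    (X : Matrix (Fin n) (Fin d) ℝ) (Bstar : Matrix (Fin d) (Fin q) ℝ)
    (W : Matrix (Fin n) (Fin q) ℝ) (lam : ℝ) (hlam0 : 0 < lam)
    (Y : Matrix (Fin n) (Fin q) ℝ) (hY : Y = X * Bstar + W)
    (Bhat : Matrix (Fin d) (Fin q) ℝ)
    (hmin : ∀ B : Matrix (Fin d) (Fin q) ℝ,
      (1 / 2) * frobNorm (Y - X * Bhat) ^ 2 + lam * l21Norm Bhat ≤
      (1 / 2) * frobNorm (Y - X * B) ^ 2 + lam * l21Norm B)
    (hlam : 2 * l2infNorm (Xᵀ * W) ≤ lam)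
    (Δ ΔS : Matrix (Fin d) (Fin q) ℝ)
    (hΔ : Δ = Bhat - Bstar)
    (hΔS : ∀ i j, ΔS i j = if Bstar i ≠ 0 then Δ i j else 0) :
    l21Norm (Δ - ΔS) ≤ 3 * l21Norm ΔS := by
  have h_rows : ∀ i, rowNorm Bstar i + rowNorm (Δ - ΔS) i ≤ rowNorm Bhat i + rowNorm ΔS i ∧
      rowNorm Δ i = rowNorm ΔS i + rowNorm (Δ - ΔS) i := by
    intro i
    by_cases h : Bstar i = 0
    · have h_on : ΔS i = 0 := by ext j; simp [hΔS, h]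
      have h_off : (Δ - ΔS) i = Δ i := by ext j; simp [hΔS, h]
      have h_hat : Δ i = Bhat i := by
        ext j
        simp [hΔ, h]
      simp [rowNorm_eq_zero h, rowNorm_eq_zero h_on, rowNorm_congr h_off, rowNorm_congr h_hat]
    · have h_on : ΔS i = Δ i := by ext j; simp [hΔS, h]
      have h_off : (Δ - ΔS) i = 0 := by ext j; simp [hΔS, h]
      rw [rowNorm_eq_zero h_off, rowNorm_congr h_on, hΔ]
      simpa using rowNorm_le_rowNorm_add_rowNorm_sub Bhat Bstar i
  have h_decomp : l21Norm Bstar + l21Norm (Δ - ΔS) ≤ l21Norm Bhat + l21Norm ΔS := by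
    simp only [l21Norm, ← Finset.sum_add_distrib]
    exact Finset.sum_le_sum fun i _ => (h_rows i).1
  have h_split : l21Norm Δ = l21Norm ΔS + l21Norm (Δ - ΔS) := by
    simp only [l21Norm, ← Finset.sum_add_distrib]
    exact Finset.sum_congr rfl fun i _ => (h_rows i).2
  have h_nonneg : 0 ≤ l21Norm Δ := Finset.sum_nonneg fun i _ => rowNorm_nonneg Δ i
  have h_basic := hmin Bstar
  have h_hat : Y - X * Bhat = W - X * Δ := by
    rw [hY, hΔ, Matrix.mul_sub]
    abel
  have h_star : Y - X * Bstar = W := by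
    rw [hY, add_sub_cancel_left]
  rw [h_hat, h_star, frobNorm_sub_sq, sum_mul_mul_apply_eq_sum_transpose_mul] at h_basic
  have h_noise := sum_mul_le_l2infNorm_mul_l21Norm (Xᵀ * W) Δ
  have h_dual := mul_le_mul_of_nonneg_right hlam h_nonneg
  have h_decomp_lam := mul_le_mul_of_nonneg_left h_decomp hlam0.le
  rw [h_split] at h_noise h_dual
  refine le_of_mul_le_mul_left ?_ hlam0
  linarith [sq_nonneg (frobNorm (X * Δ))]
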